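/- arXiv:1810.00639 — 9 statements merged into one kernel-verified Lean document; each statement's English description precedes it below -/
import Mathlib

section
/- Let R be a commutative integral domain and let x, y, z ∈ R satisfy x(1−x) = yz. Then the product of the ideals (x, y) and (1−x, y) equals the principal ideal (y); in particular, if y ≠ 0, then the ideal (x, y) is an invertible ideal of R (i.e., its associated fractional ideal is invertible in the fraction field of R). -/
/-- If `x(1-x) = yz` in an integral domain `R`, then
`(x, y) * (1 - x, y) = (y)`; in particular, if `y ≠ 0`, the fractional ideal
associated to `(x, y)` is invertible in the fraction field of `R`. -/
theorem idempotent_pair_ideal_invertible {R : Type*} [CommRing R] [IsDomain R]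
    (x y z : R) (h : x * (1 - x) = y * z) :
    Ideal.span {x, y} * Ideal.span {1 - x, y} = Ideal.span {y} ∧
      (y ≠ 0 →
        IsUnit ((Ideal.span {x, y} : Ideal R) :
          FractionalIdeal (nonZeroDivisors R) (FractionRing R))) := by
  have hmul : Ideal.span {x, y} * Ideal.span {1 - x, y} = Ideal.span {y} := by
    rw [Ideal.span_pair_mul_span_pair]
    apply le_antisymm
    · rw [Ideal.span_le]
      rintro a (rfl | rfl | rfl | rfl)
      · exact Ideal.mem_span_singleton.2 ⟨z, h⟩
      · exact Ideal.mem_span_singleton.2 ⟨x, mul_comm x y⟩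
      · exact Ideal.mem_span_singleton.2 ⟨1 - x, rfl⟩
      · exact Ideal.mem_span_singleton.2 ⟨y, rfl⟩
    · rw [Ideal.span_singleton_le_iff_mem]
      have hy : y = x * y + y * (1 - x) := by ring
      nth_rw 5 [hy]
      exact add_mem (Ideal.subset_span (by simp)) (Ideal.subset_span (by simp))
  refine ⟨hmul, fun hy => ?_⟩
  have hy' : algebraMap R (FractionRing R) y ≠ 0 := by simpa using hy
  apply isUnit_of_mul_isUnit_left
    (y := ((Ideal.span {1 - x, y} : Ideal R) :
      FractionalIdeal (nonZeroDivisors R) (FractionRing R)))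
  rw [← FractionalIdeal.coeIdeal_mul, hmul, FractionalIdeal.coeIdeal_span_singleton]
  exact IsUnit.of_mul_eq_one _ (FractionalIdeal.spanSingleton_mul_inv (FractionRing R) hy')
end

section
/- Let R be a commutative integral domain and let a, b be nonzero elements of R. If the 2×2 matrix with first row (a b) and second row (0 0) is a product of idempotent 2×2 matrices over R, then the ideal (a, b) is an invertible ideal of R. -/
/-- A product of idempotents in a monoid that is not `1` is fixed under right multiplication by
some idempotent other than `1`. -/
theorem exists_idempotent_ne_one_prod_mul_eq {M : Type*} [Monoid M] (l : List M)
    (hl : ∀ e ∈ l, e * e = e) (h1 : l.prod ≠ 1) :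
    ∃ e : M, e * e = e ∧ e ≠ 1 ∧ l.prod * e = l.prod := by
  induction l using List.reverseRecOn with
  | nil => simp at h1
  | append_singleton l e ih =>
    have he : e * e = e := hl e (by simp)
    by_cases hone : e = 1
    · subst hone
      simpa using ih (fun f hf => hl f (by simp [hf])) (by simpa using h1)
    · exact ⟨e, he, hone, by simp [mul_assoc, he]⟩

/-- If `a, b` are nonzero elements of an integral domain `R` and the
matrix `[[a, b], [0, 0]]` is a product of idempotent `2 × 2` matrices, then the ideal
`(a, b)` is invertible: `(a, b) * J = (c)` for some ideal `J` and some nonzero `c`. -/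
theorem singular_row_idempotent_factorization_invertible {R : Type*} [CommRing R]
    [IsDomain R] (a b : R) (ha : a ≠ 0) (hb : b ≠ 0)
    (h : ∃ l : List (Matrix (Fin 2) (Fin 2) R),
      (∀ E ∈ l, E * E = E) ∧ !![a, b; 0, 0] = l.prod) :
    ∃ c : R, c ≠ 0 ∧ ∃ J : Ideal R, Ideal.span {a, b} * J = Ideal.span {c} := by
  obtain ⟨l, hl, hprod⟩ := h
  have hne : l.prod ≠ 1 := by
    rw [← hprod]
    intro h
    simpa using congrFun (congrFun h 1) 1
  obtain ⟨E, hE, hE1, hfix⟩ := exists_idempotent_ne_one_prod_mul_eq l hl hne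
  rw [← hprod] at hfix
  obtain ⟨x, y, z, w, rfl⟩ : ∃ x y z w, E = !![x, y; z, w] :=
    ⟨_, _, _, _, Matrix.eta_fin_two E⟩
  have hax : a * x + b * z = a := by
    simpa [Matrix.mul_apply, Fin.sum_univ_two] using congrFun (congrFun hfix 0) 0
  have hby : a * y + b * w = b := by
    simpa [Matrix.mul_apply, Fin.sum_univ_two] using congrFun (congrFun hfix 0) 1
  have hy : x * y + y * w = y := by
    simpa [Matrix.mul_apply, Fin.sum_univ_two] using congrFun (congrFun hE 0) 1
  have hz : z * x + w * z = z := by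
    simpa [Matrix.mul_apply, Fin.sum_univ_two] using congrFun (congrFun hE 1) 0
  have htr : x + w = 1 := by
    by_contra hne
    have hne' : x + w - 1 ≠ 0 := sub_ne_zero.mpr hne
    obtain rfl : y = 0 :=
      (mul_eq_zero.mp (show (x + w - 1) * y = 0 by linear_combination hy)).resolve_left hne'
    obtain rfl : z = 0 :=
      (mul_eq_zero.mp (show (x + w - 1) * z = 0 by linear_combination hz)).resolve_left hne'
    obtain rfl : x = 1 := mul_left_cancel₀ ha (by linear_combination hax)
    obtain rfl : w = 1 := mul_left_cancel₀ hb (by linear_combination hby)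
    exact hE1 Matrix.one_fin_two.symm
  refine ⟨a, ha, Ideal.span {x, z}, le_antisymm ?_ ?_⟩
  · rw [Ideal.span_pair_mul_span_pair, Ideal.span_le]
    rintro r (rfl | rfl | rfl | rfl) <;> rw [SetLike.mem_coe, Ideal.mem_span_singleton]
    · exact ⟨x, rfl⟩
    · exact ⟨z, rfl⟩
    · exact ⟨y, by linear_combination b * htr - hby⟩
    · exact ⟨w, by linear_combination hax - a * htr⟩
  · rw [Ideal.span_singleton_le_iff_mem]
    have hmem := add_mem
      (Ideal.mul_mem_mul (Ideal.subset_span (by simp : a ∈ ({a, b} : Set R)))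
        (Ideal.subset_span (by simp : x ∈ ({x, z} : Set R))))
      (Ideal.mul_mem_mul (Ideal.subset_span (by simp : b ∈ ({a, b} : Set R)))
        (Ideal.subset_span (by simp : z ∈ ({x, z} : Set R))))
    rwa [hax] at hmem
end

section
/- If R is a commutative integral domain satisfying property (ID₂), then R is a Prüfer domain, i.e., every nonzero finitely generated ideal of R is invertible. -/
/-- A nonzero singular matrix that is a product of idempotents is fixed by right multiplication by
some idempotent other than the identity. -/
theorem Matrix.exists_idempotent_ne_one_mul_eq_self {R : Type*} [CommRing R] [Nontrivial R]
    (l : List (Matrix (Fin 2) (Fin 2) R)) (hl : ∀ E ∈ l, E * E = E) (hdet : l.prod.det = 0) :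
    ∃ E : Matrix (Fin 2) (Fin 2) R, E * E = E ∧ E ≠ 1 ∧ l.prod * E = l.prod := by
  induction l using List.reverseRecOn with
  | nil => simp at hdet
  | append_singleton l E ih =>
    have hE : E * E = E := hl E (by simp)
    by_cases h1 : E = 1
    · subst h1
      simpa using ih (fun F hF => hl F (by simp [hF])) (by simpa using hdet)
    · exact ⟨E, hE, h1, by simp [mul_assoc, hE]⟩

/-- A nontrivial idempotent `2 × 2` matrix over a domain has trace `1`. -/
theorem Matrix.trace_eq_one_of_idempotent {R : Type*} [CommRing R] [IsDomain R]
    {E : Matrix (Fin 2) (Fin 2) R} (hE : E * E = E) (h0 : E ≠ 0) (h1 : E ≠ 1) :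
    E.trace = 1 := by
  have hdet : E.det = 0 := by
    by_contra hd
    have hd1 : E.det = 1 := mul_left_cancel₀ hd (by rw [← Matrix.det_mul, hE, mul_one])
    have hu : IsUnit E := (Matrix.isUnit_iff_isUnit_det E).2 (by simp [hd1])
    exact h1 (hu.mul_left_cancel (by rw [hE, mul_one]))
  have hsmul : (E.trace - 1) • E = 0 := by
    have hsq : E * E = E.trace • E - E.det • 1 := by
      ext i j
      fin_cases i <;> fin_cases j <;>
        simp [Matrix.mul_apply, Fin.sum_univ_two, Matrix.trace, Matrix.det_fin_two] <;> ring
    rw [hdet, zero_smul, sub_zero, hE] at hsq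
    rw [sub_smul, one_smul, ← hsq, sub_self]
  exact sub_eq_zero.1 ((smul_eq_zero.1 hsmul).resolve_right h0)

/-- Property `(ID₂)` makes two-generated ideals divide a nonzero principal ideal. -/
theorem Ideal.span_pair_dvd_of_idempotent_products {R : Type*} [CommRing R] [IsDomain R]
    (hID : ∀ M : Matrix (Fin 2) (Fin 2) R, M.det = 0 →
      ∃ l : List (Matrix (Fin 2) (Fin 2) R), (∀ E ∈ l, E * E = E) ∧ M = l.prod)
    {x : R} (hx : x ≠ 0) (y : R) :
    Ideal.span {x} ⊔ Ideal.span {y} ∣ Ideal.span {x} := by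
  obtain ⟨l, hl, hM⟩ := hID !![x, y; 0, 0] (by simp)
  obtain ⟨E, hE, h1, hME⟩ :=
    Matrix.exists_idempotent_ne_one_mul_eq_self l hl (by rw [← hM]; simp)
  rw [← hM] at hME
  have h0 : E ≠ 0 := by
    rintro rfl
    exact hx (by simpa using (congrFun₂ hME 0 0).symm)
  have htr : E 0 0 + E 1 1 = 1 := by
    simpa [Matrix.trace, Fin.sum_univ_two] using Matrix.trace_eq_one_of_idempotent hE h0 h1
  have e0 : x * E 0 0 + y * E 1 0 = x := by
    simpa [Matrix.mul_apply, Fin.sum_univ_two] using congrFun₂ hME 0 0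
  have e1 : x * E 0 1 + y * E 1 1 = y := by
    simpa [Matrix.mul_apply, Fin.sum_univ_two] using congrFun₂ hME 0 1
  refine ⟨Ideal.span {E 0 0} ⊔ Ideal.span {E 1 0}, le_antisymm ?_ ?_⟩
  · rw [Ideal.span_singleton_le_iff_mem]
    have hxI : x ∈ Ideal.span {x} ⊔ Ideal.span {y} :=
      Ideal.mem_sup_left (Ideal.mem_span_singleton_self x)
    have hyI : y ∈ Ideal.span {x} ⊔ Ideal.span {y} :=
      Ideal.mem_sup_right (Ideal.mem_span_singleton_self y)
    have h := add_mem
      (Ideal.mul_mem_mul hxI (Ideal.mem_sup_left (T := Ideal.span {E 1 0})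
        (Ideal.mem_span_singleton_self (E 0 0))))
      (Ideal.mul_mem_mul hyI (Ideal.mem_sup_right (S := Ideal.span {E 0 0})
        (Ideal.mem_span_singleton_self (E 1 0))))
    rwa [e0] at h
  · simp only [Ideal.sup_mul, Ideal.mul_sup, Ideal.span_singleton_mul_span_singleton, sup_le_iff,
      Ideal.span_singleton_le_span_singleton]
    exact ⟨⟨dvd_mul_right _ _, ⟨E 0 1, by linear_combination y * htr - e1⟩⟩,
      dvd_mul_right _ _, ⟨1 - E 0 0, by linear_combination e0⟩⟩

theorem Ideal.sup_mul_sup_mul_sup {R : Type*} [CommRing R] (A B C : Ideal R) :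
    (A ⊔ B) * (B ⊔ C) * (C ⊔ A) = (A ⊔ B ⊔ C) * (A * B ⊔ B * C ⊔ C * A) := by
  simp only [← Ideal.add_eq_sup]
  have h : A * B * C + A * B * C = A * B * C := add_idem _
  calc (A + B) * (B + C) * (C + A)
      = A * A * (B + C) + B * B * (A + C) + C * C * (A + B) +
          (A * B * C + A * B * C) := by ring
    _ = A * A * (B + C) + B * B * (A + C) + C * C * (A + B) +
          (A * B * C + A * B * C + A * B * C) := by rw [h, h]
    _ = (A + B + C) * (A * B + B * C + C * A) := by ring

/-- If all two-generated ideals containing a nonzero element divide a nonzero principal ideal, then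
so do all finitely generated ones. -/
theorem Ideal.exists_dvd_span_singleton_of_span_pair {R : Type*} [CommRing R] [IsDomain R]
    (h2 : ∀ x y : R, x ≠ 0 → ∃ c : R, c ≠ 0 ∧ Ideal.span {x} ⊔ Ideal.span {y} ∣ Ideal.span {c})
    (s : Finset R) {a : R} (ha : a ≠ 0) :
    ∃ c : R, c ≠ 0 ∧ Ideal.span {a} ⊔ Ideal.span (s : Set R) ∣ Ideal.span {c} := by
  classical
  induction s using Finset.induction_on generalizing a with
  | empty => exact ⟨a, ha, by simp⟩
  | insert b s _ ih =>
    rw [Finset.coe_insert, Ideal.span_insert]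
    by_cases hb : b = 0
    · simpa [hb] using ih ha
    · obtain ⟨c, hc, hca⟩ := ih ha
      obtain ⟨d, hd, hdb⟩ := ih hb
      obtain ⟨e, he, heab⟩ := h2 b a hb
      refine ⟨c * d * e, mul_ne_zero (mul_ne_zero hc hd) he, ?_⟩
      have h := mul_dvd_mul (mul_dvd_mul hca hdb) heab
      rw [sup_comm (Ideal.span {b}) (Ideal.span (s : Set R)), Ideal.sup_mul_sup_mul_sup] at h
      rw [← Ideal.span_singleton_mul_span_singleton, ← Ideal.span_singleton_mul_span_singleton]
      rw [sup_comm (Ideal.span {b}) (Ideal.span (s : Set R)), ← sup_assoc]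
      exact dvd_of_mul_right_dvd h

/-- If an integral domain `R` satisfies `(ID₂)` (every `2 × 2` matrix of
determinant `0` is a product of idempotent matrices), then `R` is a Prüfer domain:
every nonzero finitely generated ideal of `R` is invertible. -/
theorem ID2_implies_Prufer {R : Type*} [CommRing R] [IsDomain R]
    (hID : ∀ M : Matrix (Fin 2) (Fin 2) R, M.det = 0 →
      ∃ l : List (Matrix (Fin 2) (Fin 2) R), (∀ E ∈ l, E * E = E) ∧ M = l.prod) :
    ∀ I : Ideal R, I.FG → I ≠ ⊥ →
      ∃ c : R, c ≠ 0 ∧ ∃ J : Ideal R, I * J = Ideal.span {c} := by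
  rintro I ⟨s, rfl⟩ hI
  obtain ⟨a, haI, ha⟩ := Submodule.exists_mem_ne_zero_of_ne_bot hI
  obtain ⟨c, hc, J, hJ⟩ := Ideal.exists_dvd_span_singleton_of_span_pair
    (fun x y hx => ⟨x, hx, Ideal.span_pair_dvd_of_idempotent_products hID hx y⟩) s ha
  rw [sup_eq_right.2 ((Ideal.span_singleton_le_iff_mem _).2 haI)] at hJ
  exact ⟨c, hc, J, hJ.symm⟩
end

section
/- Let R be a commutative integral domain with fraction field K, and let I₁, …, I_m, J₁, …, J_m be nonzero R-submodules of K that are fractional ideals of R. If the direct sum I₁ ⊕ ⋯ ⊕ I_m is isomorphic to J₁ ⊕ ⋯ ⊕ J_m as R-modules, then the product I₁⋯I_m is isomorphic to J₁⋯J_m as R-modules. -/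
open scoped Matrix

/-- Every `R`-linear map from a nonzero submodule of the fraction field to the fraction field is
multiplication by a scalar. -/
theorem Submodule.exists_forall_eq_mul {R K : Type*} [CommRing R] [IsDomain R] [Field K]
    [Algebra R K] [IsFractionRing R K] {I : Submodule R K} (hI : I ≠ ⊥) (f : I →ₗ[R] K) :
    ∃ q : K, ∀ x : I, f x = q * x := by
  obtain ⟨a, ha, ha0⟩ := I.exists_mem_ne_zero_of_ne_bot hI
  refine ⟨f ⟨a, ha⟩ / a, fun x => ?_⟩
  obtain ⟨s, r, hr, hsr⟩ := IsFractionRing.div_surjective (A := R) ((x : K) / a)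
  have hr0 : algebraMap R K r ≠ 0 := IsFractionRing.to_map_ne_zero_of_mem_nonZeroDivisors hr
  have hx : r • x = s • (⟨a, ha⟩ : I) := by
    ext
    simp only [Submodule.coe_smul, Algebra.smul_def]
    field_simp at hsr
    linear_combination -hsr
  have hf := congrArg f hx
  have hx' := congrArg (Subtype.val) hx
  simp only [map_smul, Submodule.coe_smul, Algebra.smul_def] at hf hx'
  field_simp
  apply mul_left_cancel₀ hr0
  linear_combination a * hf - f ⟨a, ha⟩ * hx'

/-- A linear map between finite products of nonzero submodules of the fraction field is given by
a matrix over the fraction field. -/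
theorem Submodule.exists_matrix_forall_eq_mulVec {R K ι κ : Type*} [CommRing R] [IsDomain R]
    [Field K] [Algebra R K] [IsFractionRing R K] [Fintype ι] [DecidableEq ι]
    {I : ι → Submodule R K} {J : κ → Submodule R K} (hI : ∀ i, I i ≠ ⊥)
    (f : (∀ i, I i) →ₗ[R] ∀ j, J j) :
    ∃ A : Matrix κ ι K, ∀ x, (fun j => (f x j : K)) = A *ᵥ fun i => (x i : K) := by
  choose A hA using fun j i => Submodule.exists_forall_eq_mul (hI i)
    ((J j).subtype ∘ₗ LinearMap.proj j ∘ₗ f ∘ₗ LinearMap.single R (fun i => I i) i)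
  refine ⟨Matrix.of A, fun x => funext fun j => ?_⟩
  simp only [Matrix.mulVec, dotProduct, Matrix.of_apply, ← hA]
  conv_lhs => rw [← Finset.univ_sum_single x]
  simp

theorem Submodule.coe_pi_single {R M ι : Type*} [Semiring R] [AddCommMonoid M] [Module R M]
    [DecidableEq ι] {I : ι → Submodule R M} (i : ι) (x : I i) :
    (fun k => ((Pi.single i x : ∀ i, I i) k : M)) = Pi.single i (x : M) := by
  ext k
  obtain rfl | hk := eq_or_ne k i
  · simp
  · simp [hk]

theorem Submodule.matrix_apply_mul_mem {R K ι κ : Type*} [CommRing R]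
    [Field K] [Algebra R K] [Fintype ι] [DecidableEq ι]
    {I : ι → Submodule R K} {J : κ → Submodule R K} {f : (∀ i, I i) → ∀ j, J j}
    {A : Matrix κ ι K} (hA : ∀ x, (fun j => (f x j : K)) = A *ᵥ fun i => (x i : K))
    (j : κ) (i : ι) {x : K} (hx : x ∈ I i) : A j i * x ∈ J j := by
  have h := congrFun (hA (Pi.single i ⟨x, hx⟩)) j
  rw [Submodule.coe_pi_single, Matrix.mulVec_single] at h
  have hmem := (f (Pi.single i ⟨x, hx⟩) j).2
  rw [h] at hmem
  simpa using hmem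

/-- A matrix fixing all vectors with entries in given nonzero submodules is the identity. -/
theorem Submodule.matrix_eq_one_of_mulVec_eq {R K ι : Type*} [CommRing R]
    [Field K] [Algebra R K] [Fintype ι] [DecidableEq ι]
    {I : ι → Submodule R K} (hI : ∀ i, I i ≠ ⊥) {M : Matrix ι ι K}
    (hM : ∀ x : ∀ i, I i, M *ᵥ (fun i => (x i : K)) = fun i => (x i : K)) : M = 1 := by
  ext j i
  obtain ⟨a, ha, ha0⟩ := (I i).exists_mem_ne_zero_of_ne_bot (hI i)
  have h := hM (Pi.single i ⟨a, ha⟩)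
  rw [Submodule.coe_pi_single] at h
  have h' := congrFun (h.trans (Matrix.one_mulVec _).symm) j
  simpa [-Matrix.one_mulVec, Matrix.mulVec_single, ha0] using h'

theorem Submodule.prod_mul_mem_prod {R K ι : Type*} [CommRing R] [CommRing K] [Algebra R K]
    (s : Finset ι) {I J : ι → Submodule R K} {q : ι → K}
    (h : ∀ i, ∀ x ∈ I i, q i * x ∈ J i) :
    ∀ x ∈ ∏ i ∈ s, I i, (∏ i ∈ s, q i) * x ∈ ∏ i ∈ s, J i := by
  classical
  induction s using Finset.induction_on with
  | empty => simp
  | insert i s hi ih =>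
    simp only [Finset.prod_insert hi]
    intro x hx
    induction hx using Submodule.mul_induction_on' with
    | mem_mul_mem y hy z hz =>
      rw [mul_mul_mul_comm]
      exact Submodule.mul_mem_mul (h i y hy) (ih z hz)
    | add y _ z _ hy hz => rw [mul_add]; exact add_mem hy hz

theorem Submodule.det_mul_mem_prod {R K ι : Type*} [CommRing R] [CommRing K] [Algebra R K]
    [Fintype ι] [DecidableEq ι] {I J : ι → Submodule R K} {A : Matrix ι ι K}
    (h : ∀ j i, ∀ x ∈ I i, A j i * x ∈ J j) {x : K} (hx : x ∈ ∏ i, I i) :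
    A.det * x ∈ ∏ i, J i := by
  rw [Matrix.det_apply, Finset.sum_mul]
  refine sum_mem fun σ _ => ?_
  have hσ := Submodule.prod_mul_mem_prod Finset.univ (fun i => h (σ i) i) x hx
  rw [Equiv.prod_comp σ J] at hσ
  obtain hs | hs := Int.units_eq_one_or (Equiv.Perm.sign σ) <;> simpa [hs] using hσ


/-- Kaplansky's lemma. Let `R` be an integral domain with fraction
field `K` and let `I₁, …, Iₘ, J₁, …, Jₘ` be nonzero fractional ideals of `R` (viewed as
`R`-submodules of `K`). If `I₁ ⊕ ⋯ ⊕ Iₘ ≅ J₁ ⊕ ⋯ ⊕ Jₘ` as `R`-modules, then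
`I₁⋯Iₘ ≅ J₁⋯Jₘ` as `R`-modules. -/
theorem kaplansky_direct_sum_product {R : Type*} [CommRing R] [IsDomain R]
    {K : Type*} [Field K] [Algebra R K] [IsFractionRing R K]
    (m : ℕ) (I J : Fin m → Submodule R K)
    (hI : ∀ i, I i ≠ ⊥ ∧ IsFractional (nonZeroDivisors R) (I i))
    (hJ : ∀ i, J i ≠ ⊥ ∧ IsFractional (nonZeroDivisors R) (J i))
    (h : Nonempty (((i : Fin m) → ↥(I i)) ≃ₗ[R] ((i : Fin m) → ↥(J i)))) :
    Nonempty ((↥(∏ i, I i) : Type _) ≃ₗ[R] ↥(∏ i, J i)) := by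
  obtain ⟨e⟩ := h
  obtain ⟨A, hA⟩ := Submodule.exists_matrix_forall_eq_mulVec (fun i => (hI i).1) e.toLinearMap
  obtain ⟨B, hB⟩ := Submodule.exists_matrix_forall_eq_mulVec (fun i => (hJ i).1)
    e.symm.toLinearMap
  have hBA : B * A = 1 := Submodule.matrix_eq_one_of_mulVec_eq (fun i => (hI i).1) fun x => by
    rw [← Matrix.mulVec_mulVec, ← hA, ← hB]
    simp
  have hdet : B.det * A.det = 1 := by rw [← Matrix.det_mul, hBA, Matrix.det_one]
  have hAmem := fun x => Submodule.det_mul_mem_prod (x := x)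
    fun j i _ => Submodule.matrix_apply_mul_mem hA j i
  have hBmem := fun x => Submodule.det_mul_mem_prod (x := x)
    fun j i _ => Submodule.matrix_apply_mul_mem hB j i
  refine ⟨LinearEquiv.ofLinearMap ((LinearMap.mulLeft R A.det).restrict hAmem)
    ((LinearMap.mulLeft R B.det).restrict hBmem) ?_ ?_⟩
  · refine LinearMap.ext fun x => Subtype.ext ?_
    change A.det * (B.det * (x : K)) = x
    linear_combination x * hdet
  · refine LinearMap.ext fun x => Subtype.ext ?_
    change B.det * (A.det * (x : K)) = x
    linear_combination x * hdet
end

section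
/- Let R be a commutative integral domain with fraction field K and let J be a fractional ideal of R. If R ⊕ R is isomorphic to J ⊕ R as R-modules, then J is a free R-module, i.e., J ≅ R. -/
/-- Let `R` be an integral domain with fraction field `K` and `J` a
fractional ideal of `R` (a nonzero `R`-submodule of `K` with `rJ ⊆ R` for some nonzero
`r`). If `R ⊕ R ≅ J ⊕ R` as `R`-modules, then `J` is free, i.e. `J ≅ R`. -/
theorem fractional_ideal_free_of_direct_sum_iso {R : Type*} [CommRing R] [IsDomain R]
    {K : Type*} [Field K] [Algebra R K] [IsFractionRing R K]
    (J : Submodule R K) (hJ0 : J ≠ ⊥) (hJ : IsFractional (nonZeroDivisors R) J)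
    (h : Nonempty ((R × R) ≃ₗ[R] (↥J × R))) :
    Nonempty (↥J ≃ₗ[R] R) := by
  obtain ⟨e⟩ := h
  have he : ∀ x y : R, e (x, y) = x • e (1, 0) + y • e (0, 1) := fun x y => by
    rw [← map_smul, ← map_smul, ← map_add]
    simp
  obtain ⟨⟨j₁, r₁⟩, h₁⟩ : ∃ p, e (1, 0) = p := ⟨_, rfl⟩
  obtain ⟨⟨j₂, r₂⟩, h₂⟩ : ∃ p, e (0, 1) = p := ⟨_, rfl⟩
  -- the determinant of `e` generates `J`
  have hspan : J = Submodule.span R {((r₂ • j₁ - r₁ • j₂ : J) : K)} := by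
    refine le_antisymm (fun j hj => ?_) ?_
    · obtain ⟨⟨x, y⟩, hxy⟩ := e.surjective (⟨j, hj⟩, 0)
      obtain ⟨⟨u, v⟩, huv⟩ := e.surjective (0, 1)
      rw [he, h₁, h₂] at hxy huv
      simp only [Prod.smul_mk, Prod.mk_add_mk, Prod.mk.injEq, Subtype.ext_iff,
        Submodule.coe_add, Submodule.coe_smul, Submodule.coe_zero, smul_eq_mul,
        Algebra.smul_def] at hxy huv
      obtain ⟨hj₁, hr₁⟩ := hxy
      obtain ⟨hj₂, hr₂⟩ := huv
      apply_fun algebraMap R K at hr₁ hr₂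
      simp only [map_add, map_mul, map_zero, map_one] at hr₁ hr₂
      refine Submodule.mem_span_singleton.mpr ⟨x * v - y * u, ?_⟩
      simp only [Submodule.coe_sub, Submodule.coe_smul, Algebra.smul_def, map_sub, map_mul]
      grind
    · simpa only [Submodule.span_singleton_le_iff_mem] using (r₂ • j₁ - r₁ • j₂).2
  have hd : ((r₂ • j₁ - r₁ • j₂ : J) : K) ≠ 0 := fun h0 => hJ0 (by
    rw [hspan, h0, Submodule.span_zero_singleton])
  exact ⟨(LinearEquiv.ofEq _ _ hspan).trans (LinearEquiv.toSpanNonzeroSingleton R K _ hd).symm⟩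
end

section
/- Let R be a commutative integral domain and let A and B be R-submodules of R² such that each of A and B is a direct summand of R² that is free of rank one, and A ∩ B = 0. Then there exists an R-module endomorphism β of R² with kernel equal to B and image equal to A. -/
/-- A free rank-one direct summand of `R²` is the kernel of a surjective linear form. -/
theorem exists_surjective_ker_eq_of_isCompl {R : Type*} [CommRing R]
    {B B' : Submodule R (Fin 2 → R)} (e : B ≃ₗ[R] R) (h : IsCompl B B') :
    ∃ f : (Fin 2 → R) →ₗ[R] R, LinearMap.ker f = B ∧ Function.Surjective f := by
  obtain ⟨φ, hφ⟩ : ∃ φ : (Fin 2 → R) →ₗ[R] R, ∀ x : B, φ x = e x :=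
    ⟨e.toLinearMap ∘ₗ B.projectionOnto B' h, fun x => by simp [Submodule.projectionOnto_apply_left]⟩
  set b : Fin 2 → R := ↑(e.symm 1) with hb
  have hbB : b ∈ B := (e.symm 1).2
  set c : Fin 2 → R := fun i => φ fun j => if i = j then 1 else 0 with hc
  have hφc (x : Fin 2 → R) : φ x = x 0 * c 0 + x 1 * c 1 := by
    simp only [LinearMap.pi_apply_eq_sum_univ φ x, Fin.sum_univ_two, smul_eq_mul, hc]
  have hbc : b 0 * c 0 + b 1 * c 1 = 1 := by
    rw [← hφc, hb, hφ, e.apply_symm_apply]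
  refine ⟨b 0 • LinearMap.proj 1 - b 1 • LinearMap.proj 0, ?_, fun r => ?_⟩
  · ext x
    simp only [LinearMap.mem_ker, LinearMap.sub_apply, LinearMap.smul_apply,
      LinearMap.proj_apply, smul_eq_mul]
    constructor
    · intro hx
      have hxb : x = φ x • b := by
        refine funext (Fin.forall_fin_two.2 ⟨?_, ?_⟩) <;>
          rw [Pi.smul_apply, smul_eq_mul, hφc]
        · linear_combination (-x 0) * hbc - c 1 * hx
        · linear_combination (-x 1) * hbc + c 0 * hx
      exact hxb ▸ B.smul_mem _ hbB
    · intro hx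
      have hxb : x = e ⟨x, hx⟩ • b := by
        rw [hb, ← Submodule.coe_smul, ← map_smul, smul_eq_mul, mul_one, e.symm_apply_apply]
      rw [hxb]
      simp only [Pi.smul_apply, smul_eq_mul]
      ring
  · refine ⟨r • ![-c 1, c 0], ?_⟩
    simp only [LinearMap.sub_apply, LinearMap.smul_apply, LinearMap.proj_apply, smul_eq_mul,
      Pi.smul_apply, Matrix.cons_val_zero, Matrix.cons_val_one]
    linear_combination r * hbc

/-- Let `R` be an integral domain and `A`, `B` submodules of `R²`,
each a free rank-one direct summand of `R²`, with `A ∩ B = 0`. Then there is an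
`R`-endomorphism `β` of `R²` with kernel `B` and image `A`. -/
theorem endomorphism_with_kernel_and_image {R : Type*} [CommRing R] [IsDomain R]
    (A B : Submodule R (Fin 2 → R))
    (hAfree : Nonempty (↥A ≃ₗ[R] R)) (hAsummand : ∃ A' : Submodule R (Fin 2 → R), IsCompl A A')
    (hBfree : Nonempty (↥B ≃ₗ[R] R)) (hBsummand : ∃ B' : Submodule R (Fin 2 → R), IsCompl B B')
    (hAB : A ⊓ B = ⊥) :
    ∃ β : (Fin 2 → R) →ₗ[R] (Fin 2 → R),
      LinearMap.ker β = B ∧ LinearMap.range β = A := by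
  obtain ⟨eA⟩ := hAfree
  obtain ⟨eB⟩ := hBfree
  obtain ⟨B', hB'⟩ := hBsummand
  obtain ⟨f, hker, hsurj⟩ := exists_surjective_ker_eq_of_isCompl eB hB'
  refine ⟨A.subtype ∘ₗ eA.symm.toLinearMap ∘ₗ f, ?_, ?_⟩
  · rw [LinearMap.ker_comp_of_ker_eq_bot _ A.ker_subtype,
      LinearMap.ker_comp_of_ker_eq_bot _ eA.symm.ker, hker]
  · rw [LinearMap.range_comp, LinearMap.range_comp, LinearMap.range_eq_top.2 hsurj,
      Submodule.map_top, eA.symm.range, Submodule.map_top, A.range_subtype]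
end

section
/- The ring R = ℝ[X,Y]/(X⁴ + Y⁴ + 1) is not a unique factorization domain. (Indeed, (x²+y²−1)(x²+y²+1) = 2(xy−1)(xy+1) is a non-unique factorization into indecomposable factors in R, where x, y denote the images of X, Y.) -/
open MvPolynomial in
/-- The coordinate ring `ℝ[X,Y]/(X⁴ + Y⁴ + 1)` of the affine plane curve
`x⁴ + y⁴ + 1 = 0` over `ℝ`. -/
abbrev CurveRing : Type :=
  MvPolynomial (Fin 2) ℝ ⧸
    Ideal.span {(X 0 : MvPolynomial (Fin 2) ℝ) ^ 4 + X 1 ^ 4 + 1}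

namespace QuadraticAlgebra

theorem isDomain_of_norm_ne_zero {R : Type*} [CommRing R] [IsDomain R] {a b : R}
    (h : ∀ z : QuadraticAlgebra R a b, z.norm = 0 → z = 0) :
    IsDomain (QuadraticAlgebra R a b) := by
  have : NoZeroDivisors (QuadraticAlgebra R a b) := ⟨fun {z w} hzw => by
    have hn : z.norm * w.norm = 0 := by rw [← map_mul, hzw, norm_zero]
    exact (mul_eq_zero.mp hn).imp (h z) (h w)⟩
  exact NoZeroDivisors.to_isDomain _

theorem irreducible_of_irreducible_norm {R : Type*} [CommRing R] {a b : R}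
    {z : QuadraticAlgebra R a b} (h : Irreducible z.norm) : Irreducible z := by
  refine ⟨fun hz => h.not_isUnit (isUnit_iff_norm_isUnit.mp hz), fun v w hvw => ?_⟩
  rw [isUnit_iff_norm_isUnit, isUnit_iff_norm_isUnit]
  exact h.isUnit_or_isUnit (by rw [hvw, map_mul])

theorem omega_mul_self {R : Type*} [CommRing R] {a : R} :
    (ω * ω : QuadraticAlgebra R a 0) = algebraMap R _ a := by
  ext <;> simp

/-- The ring homomorphism out of `R[√a]` extending `f` and sending `√a` to `u`. -/
def liftSqrt {R B : Type*} [CommRing R] [CommRing B] {a : R} (f : R →+* B) (u : B)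
    (hu : u * u = f a) : QuadraticAlgebra R a 0 →+* B where
  toFun z := f z.re + f z.im * u
  map_zero' := by simp
  map_one' := by simp [re_one, im_one]
  map_add' z w := by simp only [re_add, im_add, map_add]; ring
  map_mul' z w := by
    simp only [re_mul, im_mul, map_add, map_mul, map_zero]
    linear_combination -(f z.im * f w.im) * hu

theorem liftSqrt_apply {R B : Type*} [CommRing R] [CommRing B] {a : R} (f : R →+* B) (u : B)
    (hu : u * u = f a) (z : QuadraticAlgebra R a 0) :
    liftSqrt f u hu z = f z.re + f z.im * u := rfl

end QuadraticAlgebra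

namespace CurveRing

open Polynomial QuadraticAlgebra

/-- The ring `ℝ[x, z]/(x⁴ + z² + 1)`. -/
abbrev Genus1Ring : Type := QuadraticAlgebra ℝ[X] (-(X ^ 4 + 1)) 0

/-- The ring `ℝ[x, y]/(x⁴ + y⁴ + 1)`, obtained by adjoining `y = √z` to `Genus1Ring`. -/
abbrev TowerRing : Type := QuadraticAlgebra Genus1Ring ω 0

theorem degree_X_pow_four_add_one : (X ^ 4 + 1 : ℝ[X]).degree = 4 := by compute_degree!

theorem monic_X_pow_four_add_one : (X ^ 4 + 1 : ℝ[X]).Monic := by monicity!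

theorem degree_sq_add_mul_sq (p q : ℝ[X]) (hq : q ≠ 0) :
    (p ^ 2 + (X ^ 4 + 1) * q ^ 2).degree = max (2 * p.degree) (4 + 2 * q.degree) := by
  rw [degree_add_eq_of_leadingCoeff_add_ne_zero, degree_mul, degree_pow, degree_pow,
    degree_X_pow_four_add_one]
  · simp
  · rw [leadingCoeff_mul, leadingCoeff_pow, leadingCoeff_pow, monic_X_pow_four_add_one, one_mul]
    have : q.leadingCoeff ≠ 0 := leadingCoeff_ne_zero.mpr hq
    positivity

theorem norm_genus1 (s : Genus1Ring) : s.norm = s.re ^ 2 + (X ^ 4 + 1) * s.im ^ 2 := by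
  rw [norm_def]; ring

theorem norm_omega_genus1 : (ω : Genus1Ring).norm = X ^ 4 + 1 := by
  rw [norm_genus1]; simp

theorem four_le_degree_norm {s : Genus1Ring} (hs : s.im ≠ 0) : 4 ≤ s.norm.degree := by
  rw [norm_genus1, degree_sq_add_mul_sq _ _ hs, degree_eq_natDegree hs]
  exact le_max_of_le_right (by norm_cast; omega)

theorem eq_zero_of_norm_genus1_eq_zero {s : Genus1Ring} (hs : s.norm = 0) : s = 0 := by
  have him : s.im = 0 := by
    by_contra h
    have := four_le_degree_norm h
    simp [hs] at this
  rw [norm_genus1, him] at hs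
  exact QuadraticAlgebra.ext (by simpa using hs) him

instance : IsDomain Genus1Ring :=
  isDomain_of_norm_ne_zero fun _ => eq_zero_of_norm_genus1_eq_zero

theorem squarefree_X_pow_four_add_one : Squarefree (X ^ 4 + 1 : ℝ[X]) := by
  refine Separable.squarefree ⟨1, -C (1 / 4) * X, ?_⟩
  have h : (C (1 / 4) * 4 : ℝ[X]) = 1 := by
    rw [← Polynomial.C_ofNat, ← Polynomial.C_mul]; norm_num
  simp only [derivative_add, derivative_X_pow, derivative_one, Nat.cast_ofNat,
    Polynomial.C_ofNat]
  linear_combination (-X ^ 4) * h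

theorem eq_zero_of_sq_eq_X_pow_four_add_one_mul_sq {p q : ℝ[X]}
    (h : p ^ 2 = (X ^ 4 + 1) * q ^ 2) : q = 0 := by
  by_contra hq
  obtain ⟨k, rfl⟩ : q ∣ p :=
    (IsIntegrallyClosed.pow_dvd_pow_iff two_ne_zero).mp ⟨_, by rw [h, mul_comm]⟩
  have hk : k * k = X ^ 4 + 1 :=
    mul_left_cancel₀ (pow_ne_zero 2 hq) (by linear_combination h)
  have hu : IsUnit k := squarefree_X_pow_four_add_one k ⟨1, by rw [hk, mul_one]⟩
  have := degree_eq_zero_of_isUnit (hk ▸ hu.mul hu)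
  rw [degree_X_pow_four_add_one] at this
  norm_num at this

theorem eq_zero_of_norm_tower_eq_zero {w : TowerRing} (hw : w.norm = 0) : w = 0 := by
  have h : w.re * w.re = ω * (w.im * w.im) := by
    rw [norm_def] at hw; linear_combination hw
  have hn := congrArg QuadraticAlgebra.norm h
  rw [map_mul, map_mul, map_mul, norm_omega_genus1, ← sq, ← sq] at hn
  have him := eq_zero_of_norm_genus1_eq_zero (eq_zero_of_sq_eq_X_pow_four_add_one_mul_sq hn)
  exact QuadraticAlgebra.ext (by simpa [him] using h) him

instance : IsDomain TowerRing :=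
  isDomain_of_norm_ne_zero fun _ => eq_zero_of_norm_tower_eq_zero

theorem irreducible_omega_genus1 : Irreducible (ω : Genus1Ring) := by
  have unit_of_im_eq_zero {s t : Genus1Ring} (h : ω = s * t) (ht : t.im = 0) : IsUnit t := by
    have him := congrArg im h
    rw [im_mul, ht, omega_im] at him
    have hre : t.re * s.im = 1 := by linear_combination -him
    rw [isUnit_iff_norm_isUnit, norm_genus1, ht]
    simpa using (IsUnit.of_mul_eq_one _ hre).pow 2
  refine ⟨fun h => ?_, fun s t h => ?_⟩
  · have := degree_eq_zero_of_isUnit (isUnit_iff_norm_isUnit.mp h)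
    rw [norm_omega_genus1, degree_X_pow_four_add_one] at this
    norm_num at this
  · by_cases hs : s.im = 0
    · exact Or.inl (unit_of_im_eq_zero (h.trans (mul_comm s t)) hs)
    by_cases ht : t.im = 0
    · exact Or.inr (unit_of_im_eq_zero h ht)
    have hd := congrArg degree (congrArg QuadraticAlgebra.norm h)
    rw [map_mul, degree_mul, norm_omega_genus1, degree_X_pow_four_add_one] at hd
    have h8 := add_le_add (four_le_degree_norm hs) (four_le_degree_norm ht)
    rw [← hd] at h8
    exact absurd h8 (by decide)

theorem irreducible_omega_tower : Irreducible (ω : TowerRing) := by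
  refine irreducible_of_irreducible_norm ?_
  have : (ω : TowerRing).norm = -ω := by rw [norm_def]; simp
  rw [this]
  exact (Associated.neg_left (Associated.refl _)).irreducible_iff.mpr irreducible_omega_genus1

theorem X_pow_four_add_one_dvd_of_omega_dvd {p : ℝ[X]}
    (h : (ω : TowerRing) ∣ algebraMap Genus1Ring _ (algebraMap ℝ[X] _ p)) : X ^ 4 + 1 ∣ p := by
  obtain ⟨w, hw⟩ := h
  have := congrArg re (congrArg re hw)
  simp at this
  exact ⟨-w.im.im, by linear_combination this⟩

theorem omega_tower_pow_four :
    (ω : TowerRing) ^ 4 = algebraMap Genus1Ring _ (algebraMap ℝ[X] _ (-(X ^ 4 + 1))) := by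
  rw [← omega_mul_self, map_mul, ← omega_mul_self]
  ring

theorem not_prime_omega_tower : ¬ Prime (ω : TowerRing) := by
  intro hp
  have not_dvd (c : ℝ) : ¬ X ^ 4 + 1 ∣ (X ^ 2 + C c * X + 1 : ℝ[X]) := by
    have hd : (X ^ 2 + C c * X + 1 : ℝ[X]).degree = 2 := by compute_degree!
    refine fun h => absurd (degree_le_of_dvd h fun h0 => by simp [h0] at hd) ?_
    rw [hd, degree_X_pow_four_add_one]
    decide
  have hfac : (X ^ 2 + C (√2) * X + 1) * (X ^ 2 + C (-√2) * X + 1) = (X ^ 4 + 1 : ℝ[X]) := by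
    have h : (C √2 * C √2 : ℝ[X]) = 2 := by
      rw [← Polynomial.C_mul, Real.mul_self_sqrt zero_le_two, Polynomial.C_ofNat]
    rw [Polynomial.C_neg]
    linear_combination -X ^ 2 * h
  have hdvd : (ω : TowerRing) ∣ algebraMap Genus1Ring _ (algebraMap ℝ[X] _ (X ^ 4 + 1)) := by
    refine ⟨-ω ^ 3, ?_⟩
    rw [mul_neg, ← pow_succ', omega_tower_pow_four, map_neg, map_neg, neg_neg]
  have hmul := congrArg (fun p => algebraMap Genus1Ring TowerRing (algebraMap ℝ[X] _ p)) hfac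
  simp only [map_mul] at hmul
  rcases hp.dvd_or_dvd (hmul ▸ hdvd) with h | h
  · exact not_dvd _ (X_pow_four_add_one_dvd_of_omega_dvd h)
  · exact not_dvd _ (X_pow_four_add_one_dvd_of_omega_dvd h)

theorem not_uniqueFactorizationMonoid_tower : ¬ UniqueFactorizationMonoid TowerRing := fun _ =>
  not_prime_omega_tower (UniqueFactorizationMonoid.irreducible_iff_prime.mp irreducible_omega_tower)

/-- The image of the `i`-th coordinate in the coordinate ring of the curve. -/
noncomputable def coord (i : Fin 2) : CurveRing := Ideal.Quotient.mk _ (MvPolynomial.X i)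

theorem coord_relation : coord 0 ^ 4 + coord 1 ^ 4 + 1 = 0 :=
  Ideal.Quotient.eq_zero_iff_mem.mpr (Ideal.mem_span_singleton_self _)

/-- The homomorphism sending `x` and `y` to the coordinates of the curve. -/
noncomputable def ofTower : TowerRing →+* CurveRing :=
  liftSqrt (liftSqrt (aeval (R := ℝ) (coord 0)).toRingHom (coord 1 ^ 2) (by
    simp; linear_combination coord_relation)) (coord 1) (by
    rw [liftSqrt_apply]; simp [sq])

/-- The homomorphism sending the coordinates of the curve to `x` and `y`. -/
noncomputable def toTower : CurveRing →ₐ[ℝ] TowerRing :=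
  Ideal.Quotient.liftₐ _
    (MvPolynomial.aeval ![algebraMap Genus1Ring _ (algebraMap ℝ[X] _ X), ω]) (by
    intro p hp
    obtain ⟨q, rfl⟩ := Ideal.mem_span_singleton.mp hp
    rw [map_mul]
    refine mul_eq_zero_of_left ?_ _
    simp [omega_tower_pow_four])

theorem toTower_coord_zero :
    toTower (coord 0) = algebraMap Genus1Ring _ (algebraMap ℝ[X] _ X) :=
  MvPolynomial.aeval_X _ 0

theorem toTower_coord_one : toTower (coord 1) = ω :=
  MvPolynomial.aeval_X _ 1

theorem ofTower_toTower (r : CurveRing) : ofTower (toTower r) = r := by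
  have : (ofTower.comp toTower.toRingHom).comp (Ideal.Quotient.mk _) = Ideal.Quotient.mk _ := by
    refine MvPolynomial.ringHom_ext (fun c => ?_) fun i => ?_
    · have h : toTower (algebraMap ℝ _ c) =
          algebraMap Genus1Ring _ (algebraMap ℝ[X] _ (Polynomial.C c)) := toTower.commutes c
      change ofTower (toTower (algebraMap ℝ _ c)) = algebraMap ℝ _ c
      rw [h]
      simp [ofTower, liftSqrt_apply]
    · change ofTower (toTower (coord i)) = coord i
      fin_cases i
      · simp [toTower_coord_zero, ofTower, liftSqrt_apply]
      · simp [toTower_coord_one, ofTower, liftSqrt_apply]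
  obtain ⟨p, rfl⟩ := Ideal.Quotient.mk_surjective r
  exact congrArg (· p) this

theorem toTower_aeval (p : ℝ[X]) :
    toTower (aeval (coord 0) p) = algebraMap Genus1Ring _ (algebraMap ℝ[X] _ p) := by
  rw [← aeval_algHom_apply, toTower_coord_zero, aeval_algebraMap_apply, aeval_algebraMap_apply,
    aeval_X_left_apply]

theorem toTower_ofTower (w : TowerRing) : toTower (ofTower w) = w := by
  simp only [ofTower, liftSqrt_apply, map_add, map_mul, toTower_coord_one,
    AlgHom.toRingHom_eq_coe, RingHom.coe_coe, toTower_aeval, sq, omega_mul_self]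
  ext : 2 <;> simp

/-- The coordinate ring of the curve as a tower of two quadratic extensions of `ℝ[X]`. -/
noncomputable def equivTower : CurveRing ≃+* TowerRing :=
  RingEquiv.ofRingHom toTower.toRingHom ofTower (RingHom.ext toTower_ofTower) (RingHom.ext ofTower_toTower)

end CurveRing

/-- `ℝ[X,Y]/(X⁴ + Y⁴ + 1)` is an integral domain which is not a
unique factorization domain. -/
theorem curveRing_not_UFD :
    ∃ _ : IsDomain CurveRing, ¬ UniqueFactorizationMonoid CurveRing :=
  ⟨CurveRing.equivTower.toMulEquiv.isDomain _, fun h =>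
    CurveRing.not_uniqueFactorizationMonoid_tower
      (CurveRing.equivTower.toMulEquiv.uniqueFactorizationMonoid h)⟩
end

section
/- The ring R = ℝ[X,Y]/(X⁴ + Y⁴ + 1) is a Dedekind domain. -/
open Polynomial

/-- Let `B` be a domain generated over an integrally closed domain `A` by an integral element `y`.
If `f` is the minimal polynomial of `y`, then `f'(y)` multiplies every element of the fraction field
of `B` integral over `A` into `B`. -/
theorem exists_algebraMap_eq_aeval_derivative_minpoly_mul {A B L : Type*} [CommRing A] [IsDomain A]
    [IsIntegrallyClosed A] [CommRing B] [IsDomain B] [Field L] [Algebra A B] [FaithfulSMul A B]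
    [Algebra A L] [Algebra B L] [IsScalarTower A B L] [IsFractionRing B L] {y : B}
    (hadjoin : Algebra.adjoin A {y} = ⊤) (hy : IsIntegral A y) {z : L} (hz : IsIntegral A z) :
    ∃ b : B, algebraMap B L b = algebraMap B L (aeval y (derivative (minpoly A y))) * z := by
  have : FaithfulSMul A L := FaithfulSMul.trans A B L
  let K := FractionRing A
  let _ : Algebra K L := FractionRing.liftAlgebra A L
  set y' : L := algebraMap B L y with hy'
  have hy'A : IsIntegral A y' := hy.algebraMap
  have hmin : minpoly K y' = (minpoly A y).map (algebraMap A K) :=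
    minpoly.isIntegrallyClosed_eq_field_fractions K L hy
  have hmem (b : B) : algebraMap B L b ∈ Algebra.adjoin A {y'} := by
    have : (Algebra.adjoin A {y}).map (IsScalarTower.toAlgHom A B L) = Algebra.adjoin A {y'} := by
      simp [AlgHom.map_adjoin, hy']
    rw [← this, hadjoin]
    exact ⟨b, trivial, rfl⟩
  have hsurj : Function.Surjective (aeval y' : K[X] →ₐ[K] L) := by
    have hle : ∀ b : B, algebraMap B L b ∈ IntermediateField.adjoin K {y'} := fun b ↦
      Algebra.adjoin_le (S := (IntermediateField.adjoin K {y'}).toSubalgebra.restrictScalars A)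
        (by simp) (hmem b)
    intro w
    obtain ⟨b, c, -, rfl⟩ := IsFractionRing.div_surjective (A := B) w
    have hw := div_mem (hle b) (hle c)
    rwa [← IntermediateField.mem_toSubalgebra,
      IntermediateField.adjoin_simple_toSubalgebra_of_isAlgebraic
        hy'A.tower_top.isAlgebraic, Algebra.adjoin_singleton_eq_range_aeval] at hw
  obtain ⟨g, hg, hgi⟩ := exists_derivative_mul_eq_and_isIntegral_coeff (R := A) (S := K)
    (φ := (aeval y' : K[X] →ₐ[K] L).restrictScalars A) hsurj
    (f := minpoly K y') (minpoly.monic hy'A.tower_top)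
    (fun i ↦ by rw [hmin, coeff_map]; exact isIntegral_algebraMap)
    (minpoly.ker_aeval_eq_span_minpoly K y') hz
  obtain ⟨h, rfl⟩ : g ∈ Polynomial.lifts (algebraMap A K) :=
    (Polynomial.lifts_iff_coeff_lifts g).mpr fun i ↦
      IsIntegrallyClosed.isIntegral_iff.mp (hgi i)
  refine ⟨aeval y h, ?_⟩
  rw [hmin, derivative_map] at hg
  simpa only [AlgHom.coe_restrictScalars', coe_mapRingHom, aeval_map_algebraMap, hy',
    aeval_algebraMap_apply] using hg.symm

/-- The polynomial `Y ^ 4 + (X ^ 4 + 1)` in `ℝ[X][Y]`. -/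
noncomputable def curvePolynomial : ℝ[X][X] := X ^ 4 + C (X ^ 4 + 1)

theorem curvePolynomial_monic : curvePolynomial.Monic :=
  monic_X_pow_add_C _ (by norm_num)

theorem curvePolynomial_natDegree : curvePolynomial.natDegree = 4 :=
  natDegree_X_pow_add_C

theorem separable_X_pow_four_add_one : (X ^ 4 + 1 : ℝ[X]).Separable := by
  simpa [sub_neg_eq_add] using separable_X_pow_sub_C (n := 4) (-1 : ℝ) (by norm_num) (by norm_num)

theorem curvePolynomial_irreducible : Irreducible curvePolynomial := by
  have hdeg : (X ^ 4 + 1 : ℝ[X]).natDegree = 4 := natDegree_X_pow_add_C (r := (1 : ℝ))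
  have hnu : ¬ IsUnit (X ^ 4 + 1 : ℝ[X]) := fun h ↦ by
    simpa [hdeg] using natDegree_eq_zero_of_isUnit h
  have hne : (X ^ 4 + 1 : ℝ[X]) ≠ 0 := fun h ↦ by simp [h] at hdeg
  obtain ⟨p, hp, hpd⟩ := WfDvdMonoid.exists_irreducible_factor hnu hne
  have hprime : (Ideal.span {p}).IsPrime :=
    (Ideal.span_singleton_prime hp.ne_zero).mpr hp.prime
  have hc0 : curvePolynomial.coeff 0 = X ^ 4 + 1 := by
    rw [curvePolynomial, coeff_add, coeff_C_zero, coeff_X_pow, if_neg (by norm_num), zero_add]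
  refine irreducible_of_eisenstein_criterion hprime ?_ ?_ ?_ ?_ curvePolynomial_monic.isPrimitive
  · rw [curvePolynomial_monic.leadingCoeff]
    exact (Ideal.ne_top_iff_one _).mp hprime.ne_top
  · intro n hn
    rw [degree_eq_natDegree curvePolynomial_monic.ne_zero, curvePolynomial_natDegree] at hn
    have hn4 : n < 4 := by exact_mod_cast hn
    rw [Ideal.mem_span_singleton]
    rcases Nat.eq_zero_or_pos n with rfl | hpos
    · rwa [hc0]
    · rw [curvePolynomial, coeff_add, coeff_C_of_ne_zero hpos.ne', coeff_X_pow, if_neg hn4.ne,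
        add_zero]
      exact dvd_zero p
  · exact natDegree_pos_iff_degree_pos.mp (by simp [curvePolynomial_natDegree])
  · rw [hc0, Ideal.span_singleton_pow, Ideal.mem_span_singleton, sq]
    exact fun h ↦ hp.not_isUnit (separable_X_pow_four_add_one.squarefree p h)

instance : IsDomain (AdjoinRoot curvePolynomial) :=
  AdjoinRoot.isDomain_of_prime curvePolynomial_irreducible.prime

instance : Module.Finite ℝ[X] (AdjoinRoot curvePolynomial) :=
  curvePolynomial_monic.finite_adjoinRoot

instance : FaithfulSMul ℝ[X] (AdjoinRoot curvePolynomial) :=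
  (faithfulSMul_iff_algebraMap_injective _ _).mpr
    (AdjoinRoot.of.injective_of_degree_ne_zero (by
      simp [degree_eq_natDegree curvePolynomial_monic.ne_zero, curvePolynomial_natDegree]))

theorem minpoly_root_curvePolynomial :
    minpoly ℝ[X] (AdjoinRoot.root curvePolynomial) = curvePolynomial := by
  have hint := AdjoinRoot.isIntegral_root' curvePolynomial_monic
  exact eq_of_monic_of_associated (minpoly.monic hint) curvePolynomial_monic
    ((minpoly.irreducible hint).associated_of_dvd curvePolynomial_irreducible
      (minpoly.isIntegrallyClosed_dvd hint (by simp)))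

theorem swap_curvePolynomial : Bivariate.swap curvePolynomial = curvePolynomial := by
  simp only [curvePolynomial, map_add, map_pow, map_one, Bivariate.swap_X, Bivariate.swap_Y]
  ring

/-- The automorphism of `ℝ[X][Y] / (Y ^ 4 + X ^ 4 + 1)` exchanging the two coordinates. -/
noncomputable def curveSwap : AdjoinRoot curvePolynomial ≃+* AdjoinRoot curvePolynomial :=
  Ideal.quotientEquiv (Ideal.span {curvePolynomial}) (Ideal.span {curvePolynomial})
    (Bivariate.swap (R := ℝ)).toRingEquiv <| by
    rw [Ideal.map_span, Set.image_singleton]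
    exact congrArg (fun f ↦ Ideal.span {f}) swap_curvePolynomial.symm

theorem curveSwap_of_X :
    curveSwap (AdjoinRoot.of curvePolynomial X) = AdjoinRoot.root curvePolynomial :=
  congrArg (AdjoinRoot.mk curvePolynomial) (Bivariate.swap_X (R := ℝ))

theorem exists_algebraMap_eq_root_pow_three_mul {z : FractionRing (AdjoinRoot curvePolynomial)}
    (hz : IsIntegral (AdjoinRoot curvePolynomial) z) :
    ∃ b, algebraMap (AdjoinRoot curvePolynomial) _ b =
      algebraMap _ _ (4 * AdjoinRoot.root curvePolynomial ^ 3) * z := by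
  have h := exists_algebraMap_eq_aeval_derivative_minpoly_mul (A := ℝ[X])
    (AdjoinRoot.adjoinRoot_eq_top (f := curvePolynomial))
    (AdjoinRoot.isIntegral_root' curvePolynomial_monic) (isIntegral_trans _ hz)
  rw [minpoly_root_curvePolynomial] at h
  have hd : derivative curvePolynomial = 4 * X ^ 3 := by
    rw [curvePolynomial, derivative_add, derivative_C, add_zero, derivative_X_pow]
    simp [C_ofNat]
  simpa only [hd, map_mul, map_pow, map_ofNat, aeval_X] using h

instance : IsIntegrallyClosed (AdjoinRoot curvePolynomial) := by
  let B := AdjoinRoot curvePolynomial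
  let L := FractionRing B
  refine (isIntegrallyClosed_iff L).mpr fun {z} hz ↦ ?_
  let σ : L ≃+* L := IsFractionRing.ringEquivOfRingEquiv curveSwap
  have hσ (b : B) : σ (algebraMap B L b) = algebraMap B L (curveSwap b) :=
    IsFractionRing.ringEquivOfRingEquiv_algebraMap _ _
  have hσz : IsIntegral B (σ z) := by
    have := hz.map_of_comp_eq curveSwap.toRingHom σ.toRingHom (RingHom.ext fun b ↦ (hσ b).symm)
    exact this
  obtain ⟨b, hb⟩ := exists_algebraMap_eq_root_pow_three_mul hz
  obtain ⟨c, hc⟩ := exists_algebraMap_eq_root_pow_three_mul hσz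
  have hc' : algebraMap B L (curveSwap.symm c) =
      algebraMap B L (4 * AdjoinRoot.of curvePolynomial X ^ 3) * z := by
    apply σ.injective
    rw [map_mul, hσ, hσ, map_mul, map_pow, curveSwap_of_X, RingEquiv.apply_symm_apply, hc, map_ofNat]
  have hrel : AdjoinRoot.root curvePolynomial ^ 4 +
      (AdjoinRoot.of curvePolynomial X ^ 4 + 1) = 0 := by
    have h : AdjoinRoot.mk curvePolynomial (X ^ 4 + C (X ^ 4 + 1)) = 0 := AdjoinRoot.mk_self
    simpa only [map_add, map_pow, map_one, AdjoinRoot.mk_X, AdjoinRoot.mk_C] using h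
  have h4 : (algebraMap B L (algebraMap ℝ B (1 / 4))) * 4 = 1 := by
    rw [← map_ofNat (algebraMap B L) 4, ← map_ofNat (algebraMap ℝ B) 4, ← map_mul, ← map_mul]
    norm_num
  refine ⟨-algebraMap ℝ B (1 / 4) *
    (AdjoinRoot.root _ * b + AdjoinRoot.of _ X * curveSwap.symm c), ?_⟩
  have hrel' := congrArg (algebraMap B L) hrel
  simp only [map_add, map_mul, map_neg, map_pow, map_one, map_zero, map_ofNat] at hb hc' hrel' ⊢
  rw [hb, hc']
  linear_combination (-z * (algebraMap B L (algebraMap ℝ B (1 / 4))) * 4) * hrel' + z * h4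

instance : IsDedekindDomain (AdjoinRoot curvePolynomial) where
  __ := IsNoetherianRing.of_finite ℝ[X] (AdjoinRoot curvePolynomial)
  __ := Ring.DimensionLEOne.of_isIntegral ℝ[X] (AdjoinRoot curvePolynomial)
  __ := (isIntegrallyClosed_iff_isIntegralClosure
    (FractionRing (AdjoinRoot curvePolynomial))).mp inferInstance

theorem equivMvPolynomial_curvePolynomial : Bivariate.equivMvPolynomial ℝ curvePolynomial =
    MvPolynomial.X 0 ^ 4 + MvPolynomial.X 1 ^ 4 + 1 := by
  simp only [curvePolynomial, map_add, map_pow, map_one, Bivariate.equivMvPolynomial_C_X,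
    Bivariate.equivMvPolynomial_X]
  ring

/-- The identification of `ℝ[X][Y] / (Y ^ 4 + X ^ 4 + 1)` with `CurveRing`. -/
noncomputable def adjoinRootEquivCurveRing : AdjoinRoot curvePolynomial ≃+* CurveRing :=
  Ideal.quotientEquiv (Ideal.span {curvePolynomial}) _
    (Bivariate.equivMvPolynomial ℝ).toRingEquiv <| by
    rw [Ideal.map_span, Set.image_singleton]
    exact congrArg (fun f ↦ Ideal.span {f}) equivMvPolynomial_curvePolynomial.symm

theorem IsDedekindDomain.of_ringEquiv {R S : Type*} [CommRing R] [CommRing S] [IsDedekindDomain R]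
    (e : R ≃+* S) : IsDedekindDomain S :=
  have : IsDomain S := e.symm.toMulEquiv.isDomain
  have := IsIntegrallyClosed.of_equiv e
  { isNoetherianRing_of_ringEquiv R e, Ring.DimensionLEOne.of_ringEquiv e.symm,
    (isIntegrallyClosed_iff_isIntegralClosure (FractionRing S)).mp this with }

/-- `ℝ[X,Y]/(X⁴ + Y⁴ + 1)` is a Dedekind domain. -/
theorem curveRing_isDedekindDomain : IsDedekindDomain CurveRing :=
  IsDedekindDomain.of_ringEquiv adjoinRootEquivCurveRing
end

section
/- The ring Int(ℤ) of integer-valued polynomials is a discretely ordered ring: the relation defined by f < g if and only if there exists N ∈ ℤ such that f(n) < g(n) for all integers n ≥ N is a strict linear order on Int(ℤ) making it an ordered ring (compatible with addition, and with multiplication by positive elements), and every f ∈ Int(ℤ) with f > 0 satisfies f ≥ 1. -/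
open Polynomial

/-- The ring `Int(ℤ)` of integer-valued polynomials, as a subring of `ℚ[X]`. -/
noncomputable def IntZ : Subring ℚ[X] where
  carrier := {f | ∀ n : ℤ, ∃ m : ℤ, f.eval (n : ℚ) = (m : ℚ)}
  zero_mem' := fun n => ⟨0, by simp⟩
  one_mem' := fun n => ⟨1, by simp⟩
  add_mem' := by
    rintro f g hf hg n
    obtain ⟨a, ha⟩ := hf n
    obtain ⟨b, hb⟩ := hg n
    exact ⟨a + b, by simp [ha, hb]⟩
  mul_mem' := by
    rintro f g hf hg n
    obtain ⟨a, ha⟩ := hf n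
    obtain ⟨b, hb⟩ := hg n
    exact ⟨a * b, by simp [ha, hb]⟩
  neg_mem' := by
    rintro f hf n
    obtain ⟨a, ha⟩ := hf n
    exact ⟨-a, by simp [ha]⟩

/-- The order relation on `Int(ℤ)`: `f < g` iff `f(n) < g(n)` eventually (for all
integers `n ≥ N`, for some `N ∈ ℤ`). -/
def IntZ.lt (f g : IntZ) : Prop :=
  ∃ N : ℤ, ∀ n : ℤ, N ≤ n → (f : ℚ[X]).eval (n : ℚ) < (g : ℚ[X]).eval (n : ℚ)

open Filter

theorem Polynomial.eventually_eval_intCast_pos {p : ℚ[X]} (hp : 0 < p.leadingCoeff) :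
    ∀ᶠ n : ℤ in atTop, 0 < p.eval (n : ℚ) := by
  refine tendsto_intCast_atTop_atTop.eventually (p := fun x : ℚ => 0 < p.eval x) ?_
  rcases lt_or_ge 0 p.degree with h | h
  · exact (p.tendsto_atTop_of_leadingCoeff_nonneg h hp.le).eventually_gt_atTop 0
  · rw [eq_C_of_degree_le_zero h] at hp ⊢
    exact Eventually.of_forall fun x => by simpa using hp

namespace IntZ

theorem lt_iff_eventually {f g : IntZ} :
    lt f g ↔ ∀ᶠ n : ℤ in atTop, (f : ℚ[X]).eval (n : ℚ) < (g : ℚ[X]).eval (n : ℚ) :=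
  eventually_atTop.symm

theorem lt_of_leadingCoeff_sub_pos {f g : IntZ}
    (h : 0 < ((g : ℚ[X]) - (f : ℚ[X])).leadingCoeff) : lt f g :=
  lt_iff_eventually.2 <| (eventually_eval_intCast_pos h).mono fun n hn => by
    simpa using hn

theorem lt_trichotomy (f g : IntZ) : lt f g ∨ f = g ∨ lt g f := by
  rcases _root_.lt_trichotomy 0 ((g : ℚ[X]) - (f : ℚ[X])).leadingCoeff with h | h | h
  · exact Or.inl (lt_of_leadingCoeff_sub_pos h)
  · exact Or.inr (Or.inl (Subtype.ext (sub_eq_zero.1 (leadingCoeff_eq_zero.1 h.symm)).symm))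
  · refine Or.inr (Or.inr (lt_of_leadingCoeff_sub_pos ?_))
    rw [← neg_sub, leadingCoeff_neg]
    exact neg_pos.2 h

theorem not_lt_one_of_pos {f : IntZ} (hf : lt 0 f) : ¬ lt f 1 := by
  intro h
  obtain ⟨n, h0, h1⟩ := ((lt_iff_eventually.1 hf).and (lt_iff_eventually.1 h)).exists
  obtain ⟨m, hm⟩ := f.2 n
  simp only [hm, ZeroMemClass.coe_zero, OneMemClass.coe_one, eval_zero, eval_one] at h0 h1
  norm_cast at h0 h1
  omega

end IntZ

/-- `Int(ℤ)` is a discretely ordered ring under the eventual-domination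
order: the relation is irreflexive, transitive and satisfies trichotomy (a strict linear
order), it is compatible with addition and with multiplication by positive elements,
and every `f > 0` satisfies `f ≥ 1`. -/
theorem intZ_discretely_ordered :
    (∀ f : IntZ, ¬ IntZ.lt f f) ∧
    (∀ f g h : IntZ, IntZ.lt f g → IntZ.lt g h → IntZ.lt f h) ∧
    (∀ f g : IntZ, IntZ.lt f g ∨ f = g ∨ IntZ.lt g f) ∧
    (∀ f g h : IntZ, IntZ.lt f g → IntZ.lt (h + f) (h + g)) ∧
    (∀ f g h : IntZ, IntZ.lt f g → IntZ.lt 0 h → IntZ.lt (h * f) (h * g)) ∧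
    (∀ f : IntZ, IntZ.lt 0 f → f = 1 ∨ IntZ.lt 1 f) := by
  refine ⟨fun f ⟨N, hN⟩ => lt_irrefl _ (hN N le_rfl), fun f g h hfg hgh => ?_,
    IntZ.lt_trichotomy, fun f g h ⟨N, hN⟩ => ⟨N, fun n hn => ?_⟩, fun f g h hfg hh => ?_,
    fun f hf => ?_⟩
  · rw [IntZ.lt_iff_eventually] at *
    filter_upwards [hfg, hgh] with n h₁ h₂ using h₁.trans h₂
  · simpa using hN n hn
  · rw [IntZ.lt_iff_eventually] at *
    filter_upwards [hfg, hh] with n h₁ h₂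
    simpa using mul_lt_mul_of_pos_left h₁ (by simpa using h₂)
  · rcases IntZ.lt_trichotomy f 1 with h | h | h
    · exact absurd h (IntZ.not_lt_one_of_pos hf)
    · exact Or.inl h
    · exact Or.inr h
end
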